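/- Let n ≥ 2 be an integer, δ ∈ [0,1), ε₀ > 0, and let u : (0,ε₀] × ℝ^{n−1} → ℝ be a C² function, ℤ^{n−1}-periodic in the second variable y, whose graph is spacelike, i.e. (∂ₓu)² + |∇_y u|² < 1 pointwise, which satisfies the height bound |u(x,y)| ≤ δ·x everywhere, and which solves the model maximal hypersurface equation x^{n+1}·∂ₓ( x^{−n}·∂ₓu / W ) + x·Σ_{A=1}^{n−1} ∂_{y^A}( ∂_{y^A}u / W ) = 0, where W := √(1 − (∂ₓu)² − |∇_y u|²). Then there exist positive constants c, σ and ε such that |u(x,y)| ≤ c·x^{1+σ}/(1+σ) for all 0 < x ≤ ε and all y. -/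

import Mathlib

lemma hasFDerivAt_div' {E : Type*} [NormedAddCommGroup E] [NormedSpace ℝ E] {a b : E → ℝ}
    {a' b' : E →L[ℝ] ℝ} {q : E} (ha : HasFDerivAt a a' q) (hb : HasFDerivAt b b' q)
    (h0 : b q ≠ 0) :
    HasFDerivAt (fun z => a z / b z) ((1 / b q) • a' - (a q / b q ^ 2) • b') q := by
  have h1 := ha.mul ((hasDerivAt_inv h0).comp_hasFDerivAt q hb)
  have h2 : (fun z => a z / b z) = a * ((fun y => y⁻¹) ∘ b) := by
    ext z; simp [div_eq_mul_inv]
  rw [h2]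
  refine h1.congr_fderiv ?_
  refine ContinuousLinearMap.ext fun v => ?_
  simp
  ring

open Filter Topology in
/-- One-dimensional second derivative test along a line. -/
lemma line_test {E : Type*} [NormedAddCommGroup E] [NormedSpace ℝ E] (u : E → ℝ) (q e : E)
    (hu : ContDiffAt ℝ 2 u q) (ψ ψ' : ℝ → ℝ) (m : ℝ)
    (hψ : ∀ᶠ t in 𝓝 (0 : ℝ), HasDerivAt ψ (ψ' t) t) (hψ' : HasDerivAt ψ' m 0)
    (hmax : IsLocalMax (fun t : ℝ => u (q + t • e) - ψ t) 0) :
    fderiv ℝ u q e = ψ' 0 ∧ fderiv ℝ (fun z => fderiv ℝ u z e) q e ≤ m := by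
  have hline : ∀ t : ℝ, HasDerivAt (fun t : ℝ => q + t • e) e t := by
    intro t
    simpa using ((hasDerivAt_id t).smul_const e).const_add q
  have hcont : Tendsto (fun t : ℝ => q + t • e) (𝓝 0) (𝓝 q) := by
    have := (hline 0).continuousAt.tendsto
    simpa using this
  have hud : ∀ᶠ z in 𝓝 q, DifferentiableAt ℝ u z := by
    filter_upwards [hu.eventually (by simp)] with z hz
    exact hz.differentiableAt (by simp)
  have hg : ∀ᶠ t in 𝓝 (0 : ℝ),
      HasDerivAt (fun t : ℝ => u (q + t • e) - ψ t) (fderiv ℝ u (q + t • e) e - ψ' t) t := by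
    filter_upwards [hcont.eventually hud, hψ] with t h1 h2
    exact (h1.hasFDerivAt.comp_hasDerivAt t (hline t)).sub h2
  have hdd : DifferentiableAt ℝ (fun z => fderiv ℝ u z e) q := by
    have : DifferentiableAt ℝ (fderiv ℝ u) q :=
      (hu.fderiv_right (m := 1) (by norm_num)).differentiableAt (by simp)
    exact this.clm_apply (differentiableAt_const e)
  have hdd' : HasDerivAt (fun t : ℝ => fderiv ℝ u (q + t • e) e - ψ' t)
      (fderiv ℝ (fun z => fderiv ℝ u z e) q e - m) 0 := by
    have h0 : HasFDerivAt (fun z => fderiv ℝ u z e) (fderiv ℝ (fun z => fderiv ℝ u z e) q)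
        (q + (0 : ℝ) • e) := by
      simpa using hdd.hasFDerivAt
    exact (h0.comp_hasDerivAt 0 (hline 0)).sub hψ'
  have hderiv : deriv (fun t : ℝ => u (q + t • e) - ψ t) =ᶠ[𝓝 0]
      fun t => fderiv ℝ u (q + t • e) e - ψ' t := by
    filter_upwards [hg] with t ht using ht.deriv
  have hz : fderiv ℝ u q e - ψ' 0 = 0 := by
    have := hmax.hasDerivAt_eq_zero hg.self_of_nhds
    simpa using this
  refine ⟨by linarith, ?_⟩
  by_contra hcon
  push Not at hcon
  have hd2 : deriv (deriv (fun t : ℝ => u (q + t • e) - ψ t)) 0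
      = fderiv ℝ (fun z => fderiv ℝ u z e) q e - m := by
    rw [hderiv.deriv_eq]; exact hdd'.deriv
  have hmin := isLocalMin_of_deriv_deriv_pos (f := fun t : ℝ => u (q + t • e) - ψ t) (x₀ := 0)
    (by rw [hd2]; linarith) hmax.deriv_eq_zero hg.self_of_nhds.continuousAt
  have hc : (fun t : ℝ => u (q + t • e) - ψ t) =ᶠ[𝓝 0]
      fun _ => (u (q + (0:ℝ) • e) - ψ 0) := by
    filter_upwards [hmax, hmin] with t h1 h2
    exact le_antisymm h1 h2
  have : deriv (deriv (fun t : ℝ => u (q + t • e) - ψ t)) 0 = 0 := by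
    rw [hc.deriv.deriv_eq]; simp
  linarith

open Filter Topology in
/-- The maximal equation evaluated at a point whose tangential gradient vanishes. -/
lemma eq_at_crit (n k : ℕ) (u : ℝ × (Fin k → ℝ) → ℝ) (q : ℝ × (Fin k → ℝ)) (hq : 0 < q.1)
    (hu : ContDiffAt ℝ 2 u q) (r : ℝ) (hr : r ^ 2 < 1)
    (hx : fderiv ℝ u q ((1 : ℝ), (0 : Fin k → ℝ)) = r)
    (hy : ∀ A : Fin k, fderiv ℝ u q ((0 : ℝ), Pi.single A (1 : ℝ)) = 0)
    (hmax : q.1 ^ (n + 1) *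
        fderiv ℝ (fun q : ℝ × (Fin k → ℝ) =>
          q.1 ^ (-(n : ℤ)) * fderiv ℝ u q ((1 : ℝ), (0 : Fin k → ℝ)) /
            Real.sqrt (1 - (fderiv ℝ u q ((1 : ℝ), (0 : Fin k → ℝ))) ^ 2 -
              ∑ B : Fin k, (fderiv ℝ u q ((0 : ℝ), Pi.single B (1 : ℝ))) ^ 2))
          q ((1 : ℝ), (0 : Fin k → ℝ)) +
      q.1 * ∑ A : Fin k,
        fderiv ℝ (fun q : ℝ × (Fin k → ℝ) =>
          fderiv ℝ u q ((0 : ℝ), Pi.single A (1 : ℝ)) /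
            Real.sqrt (1 - (fderiv ℝ u q ((1 : ℝ), (0 : Fin k → ℝ))) ^ 2 -
              ∑ B : Fin k, (fderiv ℝ u q ((0 : ℝ), Pi.single B (1 : ℝ))) ^ 2))
          q ((0 : ℝ), Pi.single A (1 : ℝ)) = 0) :
    fderiv ℝ (fun z => fderiv ℝ u z ((1 : ℝ), (0 : Fin k → ℝ))) q ((1 : ℝ), (0 : Fin k → ℝ))
      + (1 - r ^ 2) * ∑ A : Fin k, fderiv ℝ (fun z => fderiv ℝ u z ((0 : ℝ), Pi.single A (1 : ℝ))) q
          ((0 : ℝ), Pi.single A (1 : ℝ)) = (1 - r ^ 2) * (n * r / q.1) := by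
  have hdd : ∀ e, HasFDerivAt (fun z => fderiv ℝ u z e) (fderiv ℝ (fun z => fderiv ℝ u z e) q) q := by
    intro e
    have : DifferentiableAt ℝ (fderiv ℝ u) q :=
      (hu.fderiv_right (m := 1) (by norm_num)).differentiableAt (by simp)
    exact (this.clm_apply (differentiableAt_const e)).hasFDerivAt
  set e : ℝ × (Fin k → ℝ) := ((1 : ℝ), (0 : Fin k → ℝ)) with he
  set f : Fin k → ℝ × (Fin k → ℝ) := fun A => ((0 : ℝ), Pi.single A (1 : ℝ)) with hf
  change ∀ A, fderiv ℝ u q (f A) = 0 at hy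
  have hGpos : 0 < 1 - r ^ 2 := by linarith
  set w := Real.sqrt (1 - r ^ 2) with hw
  have hwpos : 0 < w := Real.sqrt_pos.2 hGpos
  have hw2 : w ^ 2 = 1 - r ^ 2 := Real.sq_sqrt hGpos.le
  have hG : HasFDerivAt (fun z => 1 - (fderiv ℝ u z e) ^ 2 - ∑ B : Fin k, (fderiv ℝ u z (f B)) ^ 2)
      (-(2 * r) • fderiv ℝ (fun z => fderiv ℝ u z e) q) q := by
    have h1 := ((hdd e).pow 2).const_sub 1
    have h2 := HasFDerivAt.fun_sum (u := Finset.univ) (fun B _ => ((hdd (f B)).pow 2))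
    refine (h1.sub h2).congr_fderiv ?_
    refine ContinuousLinearMap.ext fun v => ?_
    simp [hy, hx]
  have hGval : 1 - (fderiv ℝ u q e) ^ 2 - ∑ B : Fin k, (fderiv ℝ u q (f B)) ^ 2 = 1 - r ^ 2 := by
    simp [hy, hx]
  have hS := hG.sqrt (by rw [hGval]; exact hGpos.ne')
  rw [hGval] at hS
  have hSne : √(1 - (fderiv ℝ u q e) ^ 2 - ∑ B : Fin k, (fderiv ℝ u q (f B)) ^ 2) ≠ 0 := by
    rw [hGval]; exact hwpos.ne'
  have hA : ∀ A, fderiv ℝ (fun z => fderiv ℝ u z (f A) /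
      √(1 - (fderiv ℝ u z e) ^ 2 - ∑ B : Fin k, (fderiv ℝ u z (f B)) ^ 2)) q (f A)
      = fderiv ℝ (fun z => fderiv ℝ u z (f A)) q (f A) / w := by
    intro A
    have := hasFDerivAt_div' (hdd (f A)) hS hSne
    rw [hGval] at this
    rw [this.fderiv]
    simp only [hy]
    simp [← hw]
    field_simp
  have hpow : HasFDerivAt (fun z : ℝ × (Fin k → ℝ) => z.1 ^ (-(n : ℤ)))
      (((-(n : ℤ) : ℤ) * q.1 ^ (-(n : ℤ) - 1) : ℝ) • ContinuousLinearMap.fst ℝ ℝ (Fin k → ℝ)) q :=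
    (hasDerivAt_zpow (-(n : ℤ)) q.1 (Or.inl hq.ne')).comp_hasFDerivAt q hasFDerivAt_fst
  have hX := (hasFDerivAt_div' (hpow.mul (hdd e)) hS hSne).fderiv
  rw [hGval] at hX
  have hX' : q.1 ^ (n + 1) * fderiv ℝ (fun z : ℝ × (Fin k → ℝ) => z.1 ^ (-(n : ℤ)) * fderiv ℝ u z e /
      √(1 - (fderiv ℝ u z e) ^ 2 - ∑ B : Fin k, (fderiv ℝ u z (f B)) ^ 2)) q e
      = - n * r / w + q.1 * (fderiv ℝ (fun z => fderiv ℝ u z e) q e) / w ^ 3 := by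
    erw [hX]
    simp only [Pi.mul_apply, hx, ← hw]
    have e1 : q.1 ^ (-(n : ℤ) - 1) = (q.1 ^ n)⁻¹ * q.1⁻¹ := by
      rw [zpow_sub_one₀ hq.ne']; simp
    rw [e1]
    have h1r : r ^ 2 = 1 - w ^ 2 := by linarith
    simp [he]
    rw [← he]
    generalize fderiv ℝ (fun z => fderiv ℝ u z e) q e = D
    field_simp
    ring_nf
    rw [h1r]
    ring
  change q.1 ^ (n + 1) * fderiv ℝ (fun z : ℝ × (Fin k → ℝ) => z.1 ^ (-(n : ℤ)) * fderiv ℝ u z e /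
      √(1 - (fderiv ℝ u z e) ^ 2 - ∑ B : Fin k, (fderiv ℝ u z (f B)) ^ 2)) q e +
      q.1 * ∑ A, fderiv ℝ (fun z => fderiv ℝ u z (f A) /
      √(1 - (fderiv ℝ u z e) ^ 2 - ∑ B : Fin k, (fderiv ℝ u z (f B)) ^ 2)) q (f A) = 0 at hmax
  rw [Finset.sum_congr rfl (fun A _ => hA A)] at hmax
  rw [hX', ← Finset.sum_div] at hmax
  change _ + (1 - r ^ 2) * ∑ A, fderiv ℝ (fun z => fderiv ℝ u z (f A)) q (f A) = _
  generalize fderiv ℝ (fun z => fderiv ℝ u z e) q e = D at *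
  generalize ∑ A, fderiv ℝ (fun z => fderiv ℝ u z (f A)) q (f A) = T at *
  rw [← hw2]
  field_simp at hmax ⊢
  linarith

open Filter Topology in
lemma upper_bound (n k : ℕ) (hn : 2 ≤ n) (δ : ℝ)
    (hδ0 : 0 ≤ δ) (hδ1 : δ < 1) (ε₀ : ℝ) (hε₀ : 0 < ε₀)
    (u : ℝ × (Fin k → ℝ) → ℝ)
    (hC2 : ContDiffOn ℝ 2 u {p : ℝ × (Fin k → ℝ) | p.1 ∈ Set.Ioc 0 ε₀})
    (hper : ∀ (p : ℝ × (Fin k → ℝ)) (m : Fin k → ℤ),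
      u (p.1, p.2 + fun A => (m A : ℝ)) = u p)
    (hheight : ∀ p : ℝ × (Fin k → ℝ), p.1 ∈ Set.Ioc 0 ε₀ → u p ≤ δ * p.1)
    (hmax : ∀ p : ℝ × (Fin k → ℝ), p.1 ∈ Set.Ioc 0 ε₀ →
      p.1 ^ (n + 1) *
        fderiv ℝ (fun q : ℝ × (Fin k → ℝ) =>
          q.1 ^ (-(n : ℤ)) * fderiv ℝ u q ((1 : ℝ), (0 : Fin k → ℝ)) /
            Real.sqrt (1 - (fderiv ℝ u q ((1 : ℝ), (0 : Fin k → ℝ))) ^ 2 -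
              ∑ B : Fin k, (fderiv ℝ u q ((0 : ℝ), Pi.single B (1 : ℝ))) ^ 2))
          p ((1 : ℝ), (0 : Fin k → ℝ)) +
      p.1 * ∑ A : Fin k,
        fderiv ℝ (fun q : ℝ × (Fin k → ℝ) =>
          fderiv ℝ u q ((0 : ℝ), Pi.single A (1 : ℝ)) /
            Real.sqrt (1 - (fderiv ℝ u q ((1 : ℝ), (0 : Fin k → ℝ))) ^ 2 -
              ∑ B : Fin k, (fderiv ℝ u q ((0 : ℝ), Pi.single B (1 : ℝ))) ^ 2))
          p ((0 : ℝ), Pi.single A (1 : ℝ)) = 0)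
    (σ c : ℝ) (hσ : σ = (1 - δ) / 2) (hc : c = (1 + δ) / 2 * ε₀ ^ (-σ))
    (p : ℝ × (Fin k → ℝ)) (hp : 0 < p.1) (hpε : p.1 ≤ ε₀) :
    u p ≤ c * p.1 ^ (1 + σ) / (1 + σ) := by
  have hσ0 : 0 < σ := by linarith
  have hεσ : ε₀ ^ (-σ) * ε₀ ^ σ = 1 := by
    rw [← Real.rpow_add hε₀]; simp
  have hεp : 0 < ε₀ ^ (-σ) := Real.rpow_pos_of_pos hε₀ _
  have hc0 : 0 < c := by rw [hc]; positivity
  have hcσ : c * ε₀ ^ σ = (1 + δ) / 2 := by rw [hc, mul_assoc, hεσ, mul_one]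
  set v : ℝ × (Fin k → ℝ) → ℝ := fun z => u z - c * z.1 ^ (1 + σ) / (1 + σ) with hv
  -- boundary value at `ε₀`
  have hbd : ∀ z : ℝ × (Fin k → ℝ), z.1 = ε₀ → v z ≤ 0 := by
    intro z hz
    have h1 := hheight z (by rw [hz]; exact ⟨hε₀, le_rfl⟩)
    have h2 : c * z.1 ^ (1 + σ) = (1 + δ) / 2 * ε₀ := by
      rw [hz, Real.rpow_add hε₀, Real.rpow_one, ← hcσ]; ring
    simp only [hv, h2]
    rw [sub_nonpos, le_div_iff₀ (by linarith)]
    rw [hz] at h1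
    have : δ * (1 + σ) ≤ (1 + δ) / 2 := by rw [hσ]; nlinarith
    calc u z * (1 + σ) ≤ δ * ε₀ * (1 + σ) := by gcongr
      _ = δ * (1 + σ) * ε₀ := by ring
      _ ≤ _ := by gcongr
  have hvle : ∀ z : ℝ × (Fin k → ℝ), 0 < z.1 → z.1 ≤ ε₀ → v z ≤ z.1 := by
    intro z hz hz'
    have h1 := hheight z ⟨hz, hz'⟩
    have : 0 < c * z.1 ^ (1 + σ) / (1 + σ) := by positivity
    simp only [hv]
    nlinarith
  by_contra hcon
  have hm : 0 < v p := by simp only [hv]; linarith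
  set η := v p / 2 with hη
  have hη0 : 0 < η := by linarith
  have hηp : η < p.1 := by linarith [hvle p hp hpε]
  -- periodic reduction
  have hred : ∀ z : ℝ × (Fin k → ℝ), ∃ y ∈ Set.Icc (0 : Fin k → ℝ) 1, v (z.1, y) = v z := by
    intro z
    refine ⟨fun A => Int.fract (z.2 A), ⟨fun A => Int.fract_nonneg _, fun A => (Int.fract_lt_one _).le⟩, ?_⟩
    have h := hper z (fun A => -⌊z.2 A⌋)
    have h' : (z.2 + fun A => ((-⌊z.2 A⌋ : ℤ) : ℝ)) = fun A => Int.fract (z.2 A) := by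
      ext A; simp [Int.fract, sub_eq_add_neg]
    rw [h'] at h
    simp only [hv, h]
  have hKsub : ∀ z ∈ Set.Icc η ε₀ ×ˢ Set.Icc (0 : Fin k → ℝ) 1, z.1 ∈ Set.Ioc 0 ε₀ := by
    rintro z ⟨⟨h1, h2⟩, _⟩
    exact ⟨hη0.trans_le h1, h2⟩
  have hvc : ContinuousOn v (Set.Icc η ε₀ ×ˢ Set.Icc (0 : Fin k → ℝ) 1) := by
    refine (hC2.continuousOn.mono hKsub).sub ?_
    refine ContinuousOn.div_const (ContinuousOn.mul continuousOn_const ?_) _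
    exact continuousOn_fst.rpow_const (fun z hz => Or.inl (hKsub z hz).1.ne')
  obtain ⟨y0, hy0, hvy0⟩ := hred p
  obtain ⟨q, hqK, hqmax⟩ := (isCompact_Icc.prod isCompact_Icc).exists_isMaxOn
    ⟨(p.1, y0), ⟨⟨hηp.le, hpε⟩, hy0⟩⟩ hvc
  have hqm : v p ≤ v q := by
    rw [← hvy0]; exact hqmax ⟨⟨hηp.le, hpε⟩, hy0⟩
  have hq0 := (hKsub q hqK).1
  have hqε : q.1 < ε₀ := by
    refine lt_of_le_of_ne (hKsub q hqK).2 fun h => ?_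
    linarith [hbd q h]
  have hglob : ∀ z : ℝ × (Fin k → ℝ), 0 < z.1 → z.1 ≤ ε₀ → v z ≤ v q := by
    intro z hz hz'
    by_cases h : η ≤ z.1
    · obtain ⟨y, hy, hvy⟩ := hred z
      rw [← hvy]; exact hqmax ⟨⟨h, hz'⟩, hy⟩
    · linarith [hvle z hz hz']
  have hu : ContDiffAt ℝ 2 u q := by
    refine hC2.contDiffAt ?_
    have : (Prod.fst : ℝ × (Fin k → ℝ) → ℝ) ⁻¹' Set.Ioo 0 ε₀ ∈ 𝓝 q :=
      continuous_fst.continuousAt.preimage_mem_nhds (Ioo_mem_nhds hq0 hqε)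
    filter_upwards [this] with z hz
    exact ⟨hz.1, hz.2.le⟩
  -- local maxima along the axes
  have hloc : ∀ e : ℝ × (Fin k → ℝ),
      IsLocalMax (fun t : ℝ => u (q + t • e) - c * (q.1 + t * e.1) ^ (1 + σ) / (1 + σ)) 0 := by
    intro e
    have hcts : ContinuousAt (fun t : ℝ => q.1 + t * e.1) 0 := by fun_prop
    have : ∀ᶠ t in 𝓝 (0 : ℝ), q.1 + t * e.1 ∈ Set.Ioo 0 ε₀ := by
      apply hcts.eventually_mem
      simpa using Ioo_mem_nhds hq0 hqε
    filter_upwards [this] with t ht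
    have := hglob (q + t • e) (by simpa using ht.1) (by simpa using ht.2.le)
    simpa [hv] using this
  set r := c * q.1 ^ σ with hr
  have hX := line_test u q ((1 : ℝ), (0 : Fin k → ℝ)) hu
    (fun t => c * (q.1 + t) ^ (1 + σ) / (1 + σ)) (fun t => c * (q.1 + t) ^ σ) (σ * r / q.1)
    (by
      have hcts : ContinuousAt (fun t : ℝ => q.1 + t) 0 := by fun_prop
      have : ∀ᶠ t in 𝓝 (0 : ℝ), q.1 + t ∈ Set.Ioi 0 := by
        apply hcts.eventually_mem
        simpa using Ioi_mem_nhds hq0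
      filter_upwards [this] with t ht
      have h := ((((hasDerivAt_id t).const_add q.1).rpow_const (p := 1 + σ)
        (Or.inl (ne_of_gt ht))).const_mul c).div_const (1 + σ)
      refine h.congr_deriv ?_
      simp
      field_simp)
    (by
      have h := (((hasDerivAt_id (0:ℝ)).const_add q.1).rpow_const (p := σ)
        (Or.inl (by simpa using hq0.ne'))).const_mul c
      refine h.congr_deriv ?_
      simp [hr, Real.rpow_sub_one hq0.ne']
      ring)
    (by simpa using hloc ((1 : ℝ), (0 : Fin k → ℝ)))
  have hY : ∀ A, _ := fun A : Fin k => line_test u q ((0 : ℝ), Pi.single A (1 : ℝ)) hu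
    (fun t => c * q.1 ^ (1 + σ) / (1 + σ)) (fun t => 0) 0
    (Eventually.of_forall fun t => hasDerivAt_const _ _) (hasDerivAt_const _ _)
    (by simpa using hloc ((0 : ℝ), Pi.single A (1 : ℝ)))
  have hr0 : 0 < r := by positivity
  have hrs : r ≤ (1 + δ) / 2 := by
    rw [← hcσ, hr]
    gcongr
  have hr1 : r ^ 2 < 1 := by nlinarith
  have key := eq_at_crit n k u q hq0 hu r hr1 (by simpa [hr] using hX.1) (fun A => (hY A).1)
    (hmax q (hKsub q hqK))
  have hT := Finset.sum_nonpos (s := Finset.univ) (fun A _ => (hY A).2)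
  have hT' := mul_nonpos_of_nonneg_of_nonpos (a := 1 - r ^ 2) (by linarith) hT
  have h1 : (1 - r ^ 2) * (n * r / q.1) ≤ σ * r / q.1 := by linarith [hX.2]
  have h2 : (1 - r ^ 2) * n ≤ σ := by
    have : (1 - r ^ 2) * n * (r / q.1) ≤ σ * (r / q.1) := by
      calc _ = (1 - r ^ 2) * (n * r / q.1) := by ring
        _ ≤ _ := h1
        _ = _ := by ring
    exact le_of_mul_le_mul_right this (by positivity)
  have hn' : (2 : ℝ) ≤ n := by exact_mod_cast hn
  have h3 : (1 - r ^ 2) * 2 ≤ (1 - r ^ 2) * n := by gcongr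
  have h4 : r ^ 2 ≤ ((1 + δ) / 2) ^ 2 := by gcongr
  nlinarith

/-- Improved decay for maximal graphs in the exact model metric
`x^{−2}(dx² − dt² + Σ(dy^A)²)`: if a `C²`, `ℤ^{n−1}`-periodic-in-`y`, spacelike graph
`t = u(x,y)` satisfies the height bound `|u| ≤ δ x` with `δ ∈ [0,1)` and solves the
model maximal hypersurface equation
`x^{n+1}∂ₓ(x^{−n}∂ₓu/W) + x Σ_A ∂_{y^A}(∂_{y^A}u/W) = 0`,
`W = √(1 − (∂ₓu)² − |∇_y u|²)`, on `(0, ε₀] × ℝ^{n−1}`, then there are positive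
constants `c, σ, ε` with `|u(x,y)| ≤ c x^{1+σ}/(1+σ)` for all `0 < x ≤ ε`. -/
theorem model_maximal_superlinear_decay (n : ℕ) (hn : 2 ≤ n) (δ : ℝ)
    (hδ0 : 0 ≤ δ) (hδ1 : δ < 1) (ε₀ : ℝ) (hε₀ : 0 < ε₀)
    (u : ℝ × (Fin (n - 1) → ℝ) → ℝ)
    (hC2 : ContDiffOn ℝ 2 u {p : ℝ × (Fin (n - 1) → ℝ) | p.1 ∈ Set.Ioc 0 ε₀})
    (hper : ∀ (p : ℝ × (Fin (n - 1) → ℝ)) (m : Fin (n - 1) → ℤ),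
      u (p.1, p.2 + fun A => (m A : ℝ)) = u p)
    (hspace : ∀ p : ℝ × (Fin (n - 1) → ℝ), p.1 ∈ Set.Ioc 0 ε₀ →
      (fderiv ℝ u p ((1 : ℝ), (0 : Fin (n - 1) → ℝ))) ^ 2 +
        ∑ A : Fin (n - 1), (fderiv ℝ u p ((0 : ℝ), Pi.single A (1 : ℝ))) ^ 2 < 1)
    (hheight : ∀ p : ℝ × (Fin (n - 1) → ℝ), p.1 ∈ Set.Ioc 0 ε₀ → |u p| ≤ δ * p.1)
    (hmax : ∀ p : ℝ × (Fin (n - 1) → ℝ), p.1 ∈ Set.Ioc 0 ε₀ →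
      p.1 ^ (n + 1) *
        fderiv ℝ (fun q : ℝ × (Fin (n - 1) → ℝ) =>
          q.1 ^ (-(n : ℤ)) * fderiv ℝ u q ((1 : ℝ), (0 : Fin (n - 1) → ℝ)) /
            Real.sqrt (1 - (fderiv ℝ u q ((1 : ℝ), (0 : Fin (n - 1) → ℝ))) ^ 2 -
              ∑ B : Fin (n - 1), (fderiv ℝ u q ((0 : ℝ), Pi.single B (1 : ℝ))) ^ 2))
          p ((1 : ℝ), (0 : Fin (n - 1) → ℝ)) +
      p.1 * ∑ A : Fin (n - 1),
        fderiv ℝ (fun q : ℝ × (Fin (n - 1) → ℝ) =>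
          fderiv ℝ u q ((0 : ℝ), Pi.single A (1 : ℝ)) /
            Real.sqrt (1 - (fderiv ℝ u q ((1 : ℝ), (0 : Fin (n - 1) → ℝ))) ^ 2 -
              ∑ B : Fin (n - 1), (fderiv ℝ u q ((0 : ℝ), Pi.single B (1 : ℝ))) ^ 2))
          p ((0 : ℝ), Pi.single A (1 : ℝ)) = 0) :
    ∃ c σ ε : ℝ, 0 < c ∧ 0 < σ ∧ 0 < ε ∧
      ∀ p : ℝ × (Fin (n - 1) → ℝ), 0 < p.1 → p.1 ≤ ε →
        |u p| ≤ c * p.1 ^ (1 + σ) / (1 + σ) := by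
  refine ⟨(1 + δ) / 2 * ε₀ ^ (-((1 - δ) / 2)), (1 - δ) / 2, ε₀, by positivity, by linarith, hε₀, ?_⟩
  intro p hp hpε
  rw [abs_le']
  refine ⟨?_, ?_⟩
  · exact upper_bound n (n - 1) hn δ hδ0 hδ1 ε₀ hε₀ u hC2 hper
      (fun p hp => (le_abs_self _).trans (hheight p hp)) hmax _ _ rfl rfl p hp hpε
  · refine upper_bound n (n - 1) hn δ hδ0 hδ1 ε₀ hε₀ (fun z => - u z) hC2.neg
      (fun p m => by rw [hper]) (fun p hp => (neg_le_abs _).trans (hheight p hp)) ?_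
      _ _ rfl rfl p hp hpε
    intro p hp
    have h := hmax p hp
    simp only [fderiv_fun_neg, neg_apply, neg_sq, mul_neg, neg_div,
      Finset.sum_neg_distrib]
    linarith
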